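/- arXiv:2404.17533 — 2 statements merged into one kernel-verified Lean document; each statement's English description precedes it below -/
import Mathlib

section
/- Let V and W be finite-dimensional real inner product spaces of the same (finite) dimension, let T : W → V be a linear map, and let S : V → V be a positive semidefinite self-adjoint endomorphism. Let σ ≥ 0 be a real number such that ⟪S v, v⟫ ≥ σ·‖v‖² for all v ∈ V (for instance, σ the smallest eigenvalue of S). Suppose U : W → V is a linear isometry and P : V → V is a positive semidefinite self-adjoint endomorphism such that P ∘ U = S ∘ T (a polar decomposition of S ∘ T). Then for every real number λ with λ ≥ ‖T‖_op one has (σ/2)·‖T − λ·U‖_HS² ≤ trace(S)·λ² − trace(P)·λ. -/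
open scoped RealInnerProductSpace

/-- The squared Hilbert–Schmidt norm of a linear map between finite-dimensional
real inner product spaces, defined as `trace (T* ∘ T)`. -/
noncomputable def hsNormSq {W V : Type*} [NormedAddCommGroup W] [InnerProductSpace ℝ W]
    [NormedAddCommGroup V] [InnerProductSpace ℝ V]
    [FiniteDimensional ℝ W] [FiniteDimensional ℝ V] (T : W →L[ℝ] V) : ℝ :=
  LinearMap.trace ℝ W (((ContinuousLinearMap.adjoint T) ∘L T : W →L[ℝ] W) : W →ₗ[ℝ] W)

theorem stmt_0 {V W : Type*}
    [NormedAddCommGroup V] [InnerProductSpace ℝ V] [FiniteDimensional ℝ V]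
    [NormedAddCommGroup W] [InnerProductSpace ℝ W] [FiniteDimensional ℝ W]
    (hdim : Module.finrank ℝ V = Module.finrank ℝ W)
    (T : W →L[ℝ] V) (S : V →L[ℝ] V)
    (hS_sa : ∀ v w : V, ⟪S v, w⟫ = ⟪v, S w⟫)
    (hS_pos : ∀ v : V, 0 ≤ ⟪S v, v⟫)
    (σ : ℝ) (hσ : 0 ≤ σ)
    (hS_lb : ∀ v : V, σ * ‖v‖ ^ 2 ≤ ⟪S v, v⟫)
    (U : W →L[ℝ] V) (hU : ∀ w : W, ‖U w‖ = ‖w‖)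
    (P : V →L[ℝ] V)
    (hP_sa : ∀ v w : V, ⟪P v, w⟫ = ⟪v, P w⟫)
    (hP_pos : ∀ v : V, 0 ≤ ⟪P v, v⟫)
    (hpolar : ∀ w : W, P (U w) = S (T w))
    (lam : ℝ) (hlam : ‖T‖ ≤ lam) :
    σ / 2 * hsNormSq (T - lam • U) ≤
      LinearMap.trace ℝ V (S : V →ₗ[ℝ] V) * lam ^ 2 -
      LinearMap.trace ℝ V (P : V →ₗ[ℝ] V) * lam := by
  have hlam0 : 0 ≤ lam := (norm_nonneg T).trans hlam
  let e := stdOrthonormalBasis ℝ W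
  let Ui : W →ₗᵢ[ℝ] V := ⟨(U : W →ₗ[ℝ] V), hU⟩
  let Ue : W ≃ₗᵢ[ℝ] V := Ui.toLinearIsometryEquiv hdim.symm
  have hUe : ∀ w, Ue w = U w := fun w => rfl
  let f : OrthonormalBasis _ ℝ V := e.map Ue
  have hf : ∀ i, f i = U (e i) := fun i => by simp [f, hUe]
  have hP : LinearMap.trace ℝ V (P : V →ₗ[ℝ] V) = ∑ i, ⟪S (T (e i)), U (e i)⟫ := by
    rw [LinearMap.trace_eq_sum_inner _ f]
    refine Finset.sum_congr rfl fun i _ => ?_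
    rw [hf, ContinuousLinearMap.coe_coe, hpolar, real_inner_comm]
  have hS : LinearMap.trace ℝ V (S : V →ₗ[ℝ] V) = ∑ i, ⟪S (U (e i)), U (e i)⟫ := by
    rw [LinearMap.trace_eq_sum_inner _ f]
    refine Finset.sum_congr rfl fun i _ => ?_
    rw [hf, ContinuousLinearMap.coe_coe, real_inner_comm]
  have hA : hsNormSq (T - lam • U) = ∑ i, ‖(T - lam • U) (e i)‖ ^ 2 := by
    rw [hsNormSq, LinearMap.trace_eq_sum_inner _ e]
    refine Finset.sum_congr rfl fun i _ => ?_
    rw [ContinuousLinearMap.coe_coe, ContinuousLinearMap.comp_apply,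
      ContinuousLinearMap.adjoint_inner_right, real_inner_self_eq_norm_sq]
  have hT : ∑ i, ⟪S (T (e i)), T (e i)⟫ ≤ lam ^ 2 * LinearMap.trace ℝ V (S : V →ₗ[ℝ] V) := by
    let Ta := ContinuousLinearMap.adjoint T
    have h1 : ∑ i, ⟪S (T (e i)), T (e i)⟫ = LinearMap.trace ℝ W
        ((Ta : V →ₗ[ℝ] W) ∘ₗ ((S : V →ₗ[ℝ] V) ∘ₗ (T : W →ₗ[ℝ] V))) := by
      rw [LinearMap.trace_eq_sum_inner _ e]
      refine Finset.sum_congr rfl fun i _ => ?_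
      simp only [LinearMap.comp_apply, ContinuousLinearMap.coe_coe, Ta]
      rw [ContinuousLinearMap.adjoint_inner_right, real_inner_comm]
    have hsym : (S : V →ₗ[ℝ] V).IsSymmetric := fun v w => hS_sa v w
    let g := hsym.eigenvectorBasis rfl
    let μ := hsym.eigenvalues rfl
    have hg : ∀ i, S (g i) = μ i • g i := fun i => hsym.apply_eigenvectorBasis rfl i
    have hgn : ∀ i, ‖g i‖ = 1 := fun i => g.orthonormal.1 i
    have hμ : ∀ i, 0 ≤ μ i := fun i => by
      have h := hS_pos (g i)
      rw [hg, real_inner_smul_left, real_inner_self_eq_norm_sq, hgn] at h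
      linarith
    rw [h1, LinearMap.trace_comp_comm', LinearMap.trace_eq_sum_inner _ g,
      LinearMap.trace_eq_sum_inner _ g, Finset.mul_sum]
    refine Finset.sum_le_sum fun i _ => ?_
    simp only [LinearMap.comp_apply, ContinuousLinearMap.coe_coe]
    rw [← hS_sa, hg, real_inner_smul_left, real_inner_smul_right, real_inner_self_eq_norm_sq, hgn,
      ← ContinuousLinearMap.adjoint_inner_left, real_inner_self_eq_norm_sq]
    have h2 : ‖Ta (g i)‖ ≤ lam := by
      have h3 := Ta.le_opNorm (g i)
      rw [hgn, mul_one] at h3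
      have h4 : ‖Ta‖ = ‖T‖ := ContinuousLinearMap.adjoint.norm_map T
      linarith
    have h5 : ‖Ta (g i)‖ ^ 2 ≤ lam ^ 2 := pow_le_pow_left₀ (norm_nonneg _) h2 2
    have h6 := mul_le_mul_of_nonneg_left h5 (hμ i)
    change μ i * ‖Ta (g i)‖ ^ 2 ≤ _
    linarith
  have hmain : σ * hsNormSq (T - lam • U) ≤ ∑ i, ⟪S (T (e i)), T (e i)⟫
      - 2 * lam * (∑ i, ⟪S (T (e i)), U (e i)⟫) + lam ^ 2 * ∑ i, ⟪S (U (e i)), U (e i)⟫ := by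
    rw [hA, Finset.mul_sum, Finset.mul_sum, Finset.mul_sum, ← Finset.sum_sub_distrib,
      ← Finset.sum_add_distrib]
    refine Finset.sum_le_sum fun i _ => (hS_lb _).trans (le_of_eq ?_)
    have hc : ⟪S (U (e i)), T (e i)⟫ = ⟪S (T (e i)), U (e i)⟫ := by
      rw [hS_sa, real_inner_comm]
    simp only [ContinuousLinearMap.sub_apply, ContinuousLinearMap.smul_apply, map_sub, map_smul,
      inner_sub_left, inner_sub_right, real_inner_smul_left, real_inner_smul_right, hc]
    ring
  rw [← hP, ← hS] at hmain
  linarith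
end

section
/- Let V and W be finite-dimensional real inner product spaces of the same (finite) dimension, let T : W → V be a nonzero linear map, and let S : V → V be a positive semidefinite self-adjoint endomorphism. Let σ ≥ 0 be a real number such that ⟪S v, v⟫ ≥ σ·‖v‖² for all v ∈ V. Suppose U : W → V is a linear isometry and P : V → V is a positive semidefinite self-adjoint endomorphism such that P ∘ U = S ∘ T. Then (σ/(2·‖T‖_op))·‖T − ‖T‖_op·U‖_HS² ≤ trace(S)·‖T‖_op − trace(P). -/
open scoped RealInnerProductSpace

theorem stmt_1 {V W : Type*}
    [NormedAddCommGroup V] [InnerProductSpace ℝ V] [FiniteDimensional ℝ V]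
    [NormedAddCommGroup W] [InnerProductSpace ℝ W] [FiniteDimensional ℝ W]
    (hdim : Module.finrank ℝ V = Module.finrank ℝ W)
    (T : W →L[ℝ] V) (hT : T ≠ 0) (S : V →L[ℝ] V)
    (hS_sa : ∀ v w : V, ⟪S v, w⟫ = ⟪v, S w⟫)
    (hS_pos : ∀ v : V, 0 ≤ ⟪S v, v⟫)
    (σ : ℝ) (hσ : 0 ≤ σ)
    (hS_lb : ∀ v : V, σ * ‖v‖ ^ 2 ≤ ⟪S v, v⟫)
    (U : W →L[ℝ] V) (hU : ∀ w : W, ‖U w‖ = ‖w‖)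
    (P : V →L[ℝ] V)
    (hP_sa : ∀ v w : V, ⟪P v, w⟫ = ⟪v, P w⟫)
    (hP_pos : ∀ v : V, 0 ≤ ⟪P v, v⟫)
    (hpolar : ∀ w : W, P (U w) = S (T w)) :
    σ / (2 * ‖T‖) * hsNormSq (T - ‖T‖ • U) ≤
      LinearMap.trace ℝ V (S : V →ₗ[ℝ] V) * ‖T‖ -
      LinearMap.trace ℝ V (P : V →ₗ[ℝ] V) := by
  classical
  set t := ‖T‖ with ht
  have htpos : 0 < t := norm_pos_iff.mpr hT
  let U' : W ≃ₗᵢ[ℝ] V :=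
    LinearIsometry.toLinearIsometryEquiv ⟨(U : W →ₗ[ℝ] V), hU⟩ hdim.symm
  have hU' : ∀ w, U' w = U w := fun w => rfl
  have hsym : (S : V →ₗ[ℝ] V).IsSymmetric := fun v w => hS_sa v w
  let e := hsym.eigenvectorBasis (n := Module.finrank ℝ V) rfl
  let s := hsym.eigenvalues (n := Module.finrank ℝ V) rfl
  have hSe : ∀ j, S (e j) = s j • e j := fun j => by
    exact hsym.apply_eigenvectorBasis rfl j
  have hs : ∀ j, s j = ⟪e j, S (e j)⟫ := fun j => by
    rw [hSe, inner_smul_right, real_inner_self_eq_norm_sq, e.norm_eq_one]; simp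
  have hs0 : ∀ j, 0 ≤ s j := fun j => by
    rw [hs, real_inner_comm]; exact hS_pos _
  let f := e.map U'.symm
  have hUf : ∀ i, U (f i) = e i := fun i => by
    rw [← hU']; simp [f]
  have hquad : ∀ v, ⟪S v, v⟫ = ∑ j, s j * ⟪e j, v⟫ ^ 2 := fun v => by
    rw [← e.sum_inner_mul_inner (S v) v]
    refine Finset.sum_congr rfl fun j _ => ?_
    rw [hS_sa, hSe, inner_smul_right, real_inner_comm v (e j)]; ring
  have htrS : LinearMap.trace ℝ V (S : V →ₗ[ℝ] V) = ∑ i, s i := by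
    rw [LinearMap.trace_eq_sum_inner _ e]
    exact Finset.sum_congr rfl fun i _ => (hs i).symm
  have htrP : LinearMap.trace ℝ V (P : V →ₗ[ℝ] V) = ∑ i, ⟪S (T (f i)), U (f i)⟫ := by
    rw [LinearMap.trace_eq_sum_inner _ e]
    refine Finset.sum_congr rfl fun i _ => ?_
    rw [← hpolar, hUf, real_inner_comm]; rfl
  have hhs : hsNormSq (T - t • U) = ∑ i, ‖T (f i) - t • U (f i)‖ ^ 2 := by
    unfold hsNormSq
    rw [LinearMap.trace_eq_sum_inner _ f]
    refine Finset.sum_congr rfl fun i _ => ?_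
    rw [← real_inner_self_eq_norm_sq]
    exact ContinuousLinearMap.adjoint_inner_right (T - t • U) (f i) ((T - t • U) (f i))
  have hA : ∑ i, ⟪S (T (f i)), T (f i)⟫ ≤ t ^ 2 * ∑ i, s i := by
    simp only [hquad]
    rw [Finset.sum_comm, Finset.mul_sum]
    refine Finset.sum_le_sum fun j _ => ?_
    rw [← Finset.mul_sum, mul_comm]
    refine mul_le_mul_of_nonneg_right ?_ (hs0 j)
    have h1 : ∑ i, ⟪e j, T (f i)⟫ ^ 2 = ‖ContinuousLinearMap.adjoint T (e j)‖ ^ 2 := by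
      rw [← f.sum_sq_inner_left]
      refine Finset.sum_congr rfl fun i _ => ?_
      rw [ContinuousLinearMap.adjoint_inner_left]
    rw [h1]
    have h2 := (ContinuousLinearMap.adjoint T).le_opNorm (e j)
    rw [e.norm_eq_one, mul_one, LinearIsometryEquiv.norm_map] at h2
    gcongr
  have hpt : ∀ i, σ * ‖T (f i) - t • U (f i)‖ ^ 2 ≤
      ⟪S (T (f i)), T (f i)⟫ - 2 * t * ⟪S (T (f i)), U (f i)⟫ + t ^ 2 * s i := fun i => by
    refine (hS_lb _).trans (le_of_eq ?_)
    have h3 : ⟪S (U (f i)), T (f i)⟫ = ⟪S (T (f i)), U (f i)⟫ := by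
      rw [hS_sa, real_inner_comm]
    have h4 : ⟪S (U (f i)), U (f i)⟫ = s i := by
      rw [hUf, real_inner_comm, ← hs]
    simp only [map_sub, map_smul, inner_sub_left, inner_sub_right, inner_smul_left,
      inner_smul_right, h3, h4, conj_trivial]
    ring
  have hsum := Finset.sum_le_sum fun i (_ : i ∈ Finset.univ) => hpt i
  rw [Finset.sum_add_distrib, Finset.sum_sub_distrib, ← Finset.mul_sum, ← Finset.mul_sum,
    ← Finset.mul_sum, ← hhs, ← htrP, ← htrS] at hsum
  rw [← htrS] at hA
  rw [div_mul_eq_mul_div, div_le_iff₀ (by positivity)]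
  nlinarith
end
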